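/- Let D = (4+o(1))ε³n → ∞ be the sum of degrees in a multigraph K generated by the configuration model in which every vertex has degree at least 3 (except possibly one vertex of degree 2) and D is even. Then there exists an absolute constant α > 0 such that with probability tending to 1, every set S of vertices with d_K(S) ≤ |E(K)| satisfies e(S, Sᶜ) ≥ α d_K(S); i.e., K is an α-edge-expander. -/

import Mathlib

open Filter Finset

theorem factorial_mul_pow_le (a b : ℕ) : a.factorial * a ^ b ≤ b.factorial * a ^ a := by
  rcases le_total a b with h | h
  · obtain ⟨c, rfl⟩ := Nat.exists_eq_add_of_le h
    have := Nat.factorial_mul_pow_le_factorial (m := a) (n := c)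
    calc a.factorial * a ^ (a + c) = a.factorial * a ^ c * a ^ a := by ring
      _ ≤ a.factorial * (a + 1) ^ c * a ^ a := by gcongr; omega
      _ ≤ _ := by gcongr
  · obtain ⟨c, rfl⟩ := Nat.exists_eq_add_of_le h
    calc (b + c).factorial * (b + c) ^ b ≤ b.factorial * (b + c) ^ c * (b + c) ^ b := by
          gcongr
          have e := Nat.factorial_mul_descFactorial (Nat.le_add_left c b)
          rw [Nat.add_sub_cancel] at e
          rw [← e]
          gcongr
          exact Nat.descFactorial_le_pow _ _
      _ = _ := by ring

theorem choose_mul_pow_le {m t i : ℕ} (ht : t ≤ m) (hi : i ≤ m) :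
    m.choose i * (t ^ i * (m - t) ^ (m - i)) ≤ m.choose t * (t ^ t * (m - t) ^ (m - t)) := by
  have h1 := Nat.mul_le_mul (factorial_mul_pow_le t i) (factorial_mul_pow_le (m - t) (m - i))
  have e1 := Nat.choose_mul_factorial_mul_factorial ht
  have e2 := Nat.choose_mul_factorial_mul_factorial hi
  have p : 0 < i.factorial * (m - i).factorial * (t.factorial * (m - t).factorial) := by positivity
  refine Nat.le_of_mul_le_mul_left ?_ p
  calc _ = (m.choose i * i.factorial * (m - i).factorial) *
          (t.factorial * t ^ i * ((m - t).factorial * (m - t) ^ (m - i))) := by ring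
    _ ≤ (m.choose i * i.factorial * (m - i).factorial) *
          (i.factorial * t ^ t * ((m - i).factorial * (m - t) ^ (m - t))) := by gcongr
    _ = (m.choose t * t.factorial * (m - t).factorial) *
          (i.factorial * t ^ t * ((m - i).factorial * (m - t) ^ (m - t))) := by rw [e1, e2]
    _ = _ := by ring

theorem one_add_pow_le_choose {m t : ℕ} (ht : t < m) :
    (1 + (t : ℝ) / (m - t : ℕ)) ^ m ≤ (m + 1) * m.choose t * ((t : ℝ) / (m - t : ℕ)) ^ t := by
  have hq : (0 : ℝ) < (m - t : ℕ) := by exact_mod_cast Nat.sub_pos_of_lt ht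
  have key : ∀ i ∈ range (m + 1), ((t : ℝ) / (m - t : ℕ)) ^ i * 1 ^ (m - i) * m.choose i ≤
      m.choose t * ((t : ℝ) / (m - t : ℕ)) ^ t := by
    intro i hi
    have hi : i ≤ m := by simpa [Nat.lt_succ_iff] using hi
    have h : (m.choose i * (t ^ i * (m - t : ℕ) ^ (m - i)) : ℝ) ≤
        m.choose t * (t ^ t * (m - t : ℕ) ^ (m - t)) := by
      exact_mod_cast choose_mul_pow_le ht.le hi
    have e : ∀ j ≤ m, ((t : ℝ) / (m - t : ℕ)) ^ j =
        t ^ j * (m - t : ℕ) ^ (m - j) / (m - t : ℕ) ^ m := by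
      intro j hj
      rw [div_pow, div_eq_div_iff (by positivity) (by positivity), mul_assoc, ← pow_add,
        Nat.sub_add_cancel hj]
    rw [e i hi, e t ht.le, one_pow, mul_one, mul_comm, mul_div_assoc', mul_div_assoc']
    gcongr
  rw [add_comm, add_pow]
  calc _ ≤ ∑ i ∈ range (m + 1), m.choose t * ((t : ℝ) / (m - t : ℕ)) ^ t := sum_le_sum key
    _ = _ := by simp; ring

theorem two_pow_le_choose {m t : ℕ} (h : 2 * t ≤ m) : 2 ^ t ≤ m.choose t := by
  have h1 : 2 ^ t ≤ (2 * t).choose t := by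
    rw [← Nat.centralBinom_eq_two_mul_choose]
    clear h
    induction t with
    | zero => simp
    | succ t ih =>
      have := Nat.succ_mul_centralBinom_succ t
      refine Nat.le_of_mul_le_mul_left ?_ t.succ_pos
      rw [this, pow_succ]
      nlinarith
  exact h1.trans (Nat.choose_le_choose t h)

theorem pow_le_choose_of_le {m t : ℕ} (h : 2 * t ≤ m) (ht : t ≤ 24) :
    (m : ℝ) ^ t ≤ 2 ^ 24 * (Nat.factorial 24) * m.choose t := by
  have h1 := Nat.pow_le_choose (α := ℝ) t m
  rw [div_le_iff₀' (by positivity)] at h1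
  have h2 : (m : ℝ) ≤ 2 * (m + 1 - t : ℕ) := by
    exact_mod_cast (by omega : m ≤ 2 * (m + 1 - t))
  calc (m : ℝ) ^ t ≤ (2 * (m + 1 - t : ℕ)) ^ t := by gcongr
    _ = 2 ^ t * (m + 1 - t : ℕ) ^ t := by rw [mul_pow]
    _ ≤ 2 ^ t * (t.factorial * m.choose t) := by gcongr
    _ ≤ 2 ^ 24 * (Nat.factorial 24 * m.choose t) := by gcongr; norm_num
    _ = _ := by ring

theorem choose_mono_of_le_half {m r t : ℕ} (hr : r ≤ t) (ht : 2 * t ≤ m) :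
    m.choose r ≤ m.choose t := by
  induction t, hr using Nat.le_induction with
  | base => rfl
  | succ t _ ih => exact (ih (by omega)).trans (Nat.choose_le_succ_of_lt_half_left (by omega))

theorem choose_pow_twelve_le {m t k : ℕ} (hk : 200 * k ≤ t) (ht : 2 * t ≤ m) :
    ((2 * t + k).choose k : ℝ) ^ 12 ≤ m.choose t := by
  have h1 : ((2 * t + k).choose k : ℝ) ≤ 200 ^ k * (201 / 200) ^ (2 * t + k) := by
    have := add_pow (1 / 200 : ℝ) 1 (2 * t + k)
    have h2 : (1 / 200 : ℝ) ^ k * (2 * t + k).choose k ≤ (1 / 200 + 1) ^ (2 * t + k) := by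
      rw [this]
      refine le_trans (le_of_eq ?_) (single_le_sum
        (f := fun i => (1 / 200 : ℝ) ^ i * 1 ^ (2 * t + k - i) * (2 * t + k).choose i)
        (fun i _ => by positivity) (mem_range.2 (by omega : k < 2 * t + k + 1)))
      simp
    rw [one_div_pow, one_div, inv_mul_le_iff₀ (by positivity)] at h2
    norm_num at h2 ⊢
    exact h2
  calc ((2 * t + k).choose k : ℝ) ^ 12 ≤ (200 ^ k * (201 / 200) ^ (2 * t + k)) ^ 12 := by gcongr
    _ = (200 ^ 12 * (201 / 200) ^ 12) ^ k * ((201 / 200) ^ 24) ^ t := by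
        rw [mul_pow, mul_pow]; simp only [← pow_mul]; ring
    _ ≤ ((17 / 10) ^ 200) ^ k * (115 / 100) ^ t := by gcongr <;> norm_num
    _ ≤ (17 / 10) ^ t * (115 / 100) ^ t := by
        rw [← pow_mul]; gcongr; norm_num
    _ ≤ 2 ^ t := by rw [← mul_pow]; gcongr; norm_num
    _ ≤ m.choose t := by exact_mod_cast two_pow_le_choose ht

theorem large_term_bound {m t k : ℕ} {N : ℝ} (hN : 0 ≤ N) (hk : 200 * k ≤ t) (ht : 24 ≤ t)
    (htm : 2 * t ≤ m)
    (h : ∀ y : ℝ, 0 < y → y ≤ 1 → N ^ 3 * y ^ (2 * t + k) ≤ 8 * (1 + y) ^ (2 * m)) :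
    N * (2 * t + k).choose k / m.choose t ≤
      (8 ^ 4 * 2 ^ 9 * (2 ^ 24 * (Nat.factorial 24)) ^ 2) / m ^ 3 := by
  have hm : (1 : ℝ) ≤ m := by exact_mod_cast (by omega : 1 ≤ m)
  have hmt : (0 : ℝ) < (m - t : ℕ) := by exact_mod_cast (by omega : 0 < m - t)
  have hB := one_add_pow_le_choose (by omega : t < m)
  have hC := choose_pow_twelve_le hk htm
  have hC2 : (m : ℝ) ^ 24 ≤ 2 ^ 24 * (Nat.factorial 24) * m.choose t :=
    (pow_le_choose_of_le (by omega) le_rfl).trans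
      (by gcongr; exact choose_mono_of_le_half ht htm)
  have hy0 : 0 < (t : ℝ) / (m - t : ℕ) := by
    have : (0 : ℝ) < t := by exact_mod_cast (by omega : 0 < t)
    positivity
  have hy1 : (t : ℝ) / (m - t : ℕ) ≤ 1 := by
    rw [div_le_one hmt]; exact_mod_cast (by omega : t ≤ m - t)
  have hy := h _ hy0 hy1
  generalize (t : ℝ) / (m - t : ℕ) = y at *
  have hC0 : (0 : ℝ) < m.choose t := by exact_mod_cast Nat.choose_pos (by omega)
  generalize ((2 * t + k).choose k : ℝ) = E at *
  generalize (m.choose t : ℝ) = C at *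
  generalize hc : (2 ^ 24 * (Nat.factorial 24) : ℝ) = c at *
  have hc1 : 1 ≤ c := by rw [← hc]; norm_num [Nat.factorial]
  have hA1 : 1 ≤ (m + 1) * C * y ^ t := (one_le_pow₀ (by linarith)).trans hB
  have hN1 : N ^ 12 * y ^ (4 * k) ≤ 8 ^ 4 * ((m + 1) * C) ^ 8 := by
    have h1 : (N ^ 3 * y ^ (2 * t + k)) ^ 4 ≤ (8 * ((m + 1) * C * y ^ t) ^ 2) ^ 4 := by
      refine pow_le_pow_left₀ (by positivity) (hy.trans ?_) 4
      rw [mul_comm 2 m, pow_mul]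
      gcongr
    refine le_of_mul_le_mul_right ?_ (by positivity : 0 < y ^ (8 * t))
    calc _ = (N ^ 3 * y ^ (2 * t + k)) ^ 4 := by ring
      _ ≤ _ := h1
      _ = _ := by ring
  have hN2 : N ^ 12 ≤ 8 ^ 4 * ((m + 1) * C) ^ 9 := by
    calc N ^ 12 ≤ N ^ 12 * ((m + 1) * C * y ^ t) := le_mul_of_one_le_right (by positivity) hA1
      _ = N ^ 12 * y ^ t * ((m + 1) * C) := by ring
      _ ≤ N ^ 12 * y ^ (4 * k) * ((m + 1) * C) := by
        have := pow_le_pow_of_le_one hy0.le hy1 (by omega : 4 * k ≤ t)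
        gcongr
      _ ≤ 8 ^ 4 * ((m + 1) * C) ^ 8 * ((m + 1) * C) := by gcongr
      _ = _ := by ring
  have hm2 : (m : ℝ) ^ 48 ≤ c ^ 2 * C ^ 2 := by
    calc (m : ℝ) ^ 48 = (m ^ 24) ^ 2 := by ring
      _ ≤ (c * C) ^ 2 := by gcongr
      _ = _ := by ring
  have hK : (1 : ℝ) ≤ 8 ^ 4 * 2 ^ 9 * c ^ 2 := by
    have : 1 ≤ c ^ 2 := one_le_pow₀ hc1
    linarith
  have hKK := le_self_pow₀ hK (by norm_num : 12 ≠ 0)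
  refine le_of_pow_le_pow_left₀ (by norm_num : 12 ≠ 0) (by positivity) ?_
  rw [div_pow, div_pow, mul_pow, div_le_div_iff₀ (by positivity) (by positivity)]
  calc N ^ 12 * E ^ 12 * (m ^ 3) ^ 12 ≤ (8 ^ 4 * ((m + m) * C) ^ 9) * C * (m ^ 3) ^ 12 := by
        gcongr
        refine hN2.trans ?_
        gcongr
    _ = 8 ^ 4 * 2 ^ 9 * C ^ 10 * m ^ 45 := by ring
    _ ≤ 8 ^ 4 * 2 ^ 9 * C ^ 10 * m ^ 48 :=
        mul_le_mul_of_nonneg_left (pow_le_pow_right₀ hm (by norm_num)) (by positivity)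
    _ ≤ 8 ^ 4 * 2 ^ 9 * C ^ 10 * (c ^ 2 * C ^ 2) := by gcongr
    _ = (8 ^ 4 * 2 ^ 9 * c ^ 2) * C ^ 12 := by ring
    _ ≤ _ := by gcongr

theorem small_term_bound {m t : ℕ} {N : ℝ} (hN : 0 ≤ N) (ht : 1 ≤ t) (ht2 : t ≤ 24)
    (htm : 2 * t ≤ m)
    (h : ∀ y : ℝ, 0 < y → y ≤ 1 → N ^ 3 * y ^ (2 * t) ≤ 8 * (1 + y) ^ (2 * m)) :
    N / m.choose t ≤ (72 * (2 ^ 24 * (Nat.factorial 24)) ^ 3 / m) ^ (1 / 3 : ℝ) := by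
  have hm : (1 : ℝ) ≤ m := by exact_mod_cast (by omega : 1 ≤ m)
  have hC := pow_le_choose_of_le htm ht2
  have hC0 : (0 : ℝ) < m.choose t := by exact_mod_cast Nat.choose_pos (by omega)
  have hy := h (1 / m) (by positivity) (by rw [div_le_one (by positivity)]; exact hm)
  have he : (1 + 1 / (m : ℝ)) ^ (2 * m) ≤ 9 := by
    have h1 : (1 + 1 / (m : ℝ)) ^ m ≤ 3 := by
      calc (1 + 1 / (m : ℝ)) ^ m ≤ (Real.exp (1 / m)) ^ m := by
            gcongr; rw [add_comm]; exact Real.add_one_le_exp _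
        _ = Real.exp 1 := by rw [← Real.exp_nat_mul]; congr 1; field_simp
        _ ≤ 3 := Real.exp_one_lt_three.le
    rw [mul_comm, pow_mul]
    calc _ ≤ (3 : ℝ) ^ 2 := by gcongr
      _ = 9 := by norm_num
  generalize (m.choose t : ℝ) = C at *
  generalize (2 ^ 24 * (Nat.factorial 24) : ℝ) = c at *
  have h3 : (N / C) ^ 3 ≤ 72 * c ^ 3 / m := by
    rw [one_div, inv_pow, ← div_eq_mul_inv, div_le_iff₀ (by positivity)] at hy
    rw [div_pow, div_le_div_iff₀ (by positivity) (by positivity)]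
    calc N ^ 3 * m ≤ 8 * 9 * m ^ (2 * t) * m := by
          gcongr
          exact hy.trans (by gcongr; simpa using he)
      _ = 72 * m ^ (2 * t + 1) := by ring
      _ ≤ 72 * m ^ (t * 3) :=
          mul_le_mul_of_nonneg_left (pow_le_pow_right₀ hm (by omega)) (by norm_num)
      _ = 72 * (m ^ t) ^ 3 := by rw [pow_mul]
      _ ≤ 72 * (c * C) ^ 3 := by gcongr
      _ = _ := by ring
  have := Real.rpow_le_rpow (by positivity) h3 (by norm_num : (0 : ℝ) ≤ 1 / 3)
  refine le_trans (le_of_eq ?_) this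
  rw [← Real.rpow_natCast, ← Real.rpow_mul (by positivity)]
  norm_num

theorem card_subsets_pow_three_mul_le {W : Type*} [Fintype W] [DecidableEq W] {deg : W → ℕ} {m : ℕ}
    (hdeg : ∀ v, 3 ≤ deg v ∨ deg v = 2) (hdeg2 : #{v | deg v = 2} ≤ 1)
    (hsum : ∑ v, deg v = 2 * m) (s : ℕ) {y : ℝ} (hy : 0 < y) (hy1 : y ≤ 1) :
    (#{S : Finset W | ∑ v ∈ S, deg v = s} : ℝ) ^ 3 * y ^ s ≤ 8 * (1 + y) ^ (2 * m) := by
  obtain ⟨x, hx, rfl⟩ : ∃ x : ℝ, 0 < x ∧ x ^ 3 = y :=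
    ⟨y ^ (1 / 3 : ℝ), by positivity, by
      rw [← Real.rpow_natCast, ← Real.rpow_mul hy.le]; norm_num⟩
  have hx1 : x ≤ 1 := by
    by_contra! h
    exact absurd (one_lt_pow₀ h (by norm_num : 3 ≠ 0)) (by linarith)
  have hcard : 3 * #{v | ¬ deg v = 2} ≤ 2 * m := by
    rw [← hsum, mul_comm, ← smul_eq_mul, ← sum_const]
    refine (sum_le_sum (g := deg) fun v hv => ?_).trans
      (sum_le_sum_of_subset (filter_subset _ _))
    have := hdeg v
    simp at hv
    omega
  have h1 : (#{S : Finset W | ∑ v ∈ S, deg v = s} : ℝ) * x ^ s ≤ ∏ v, (1 + x ^ deg v) := by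
    rw [prod_one_add, powerset_univ, ← nsmul_eq_mul, ← sum_const]
    refine le_trans (le_of_eq (sum_congr rfl fun S hS => ?_))
      (sum_le_sum_of_subset_of_nonneg (filter_subset _ _) fun S _ _ => ?_)
    · rw [prod_pow_eq_pow_sum, (mem_filter.1 hS).2]
    · positivity
  have h2 : ∏ v, (1 + x ^ deg v) ≤ 2 * (1 + x ^ 3) ^ #{v | ¬ deg v = 2} := by
    calc ∏ v, (1 + x ^ deg v) ≤ ∏ v, if deg v = 2 then 2 else 1 + x ^ 3 := by
          refine prod_le_prod (fun v _ => by positivity) fun v _ => ?_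
          split_ifs with h
          · have := pow_le_one₀ (n := deg v) hx.le hx1
            linarith
          · have := pow_le_pow_of_le_one hx.le hx1 ((hdeg v).resolve_right h)
            linarith
      _ = 2 ^ #{v | deg v = 2} * (1 + x ^ 3) ^ #{v | ¬ deg v = 2} := by
          rw [prod_ite, prod_const, prod_const]
      _ ≤ 2 ^ 1 * (1 + x ^ 3) ^ #{v | ¬ deg v = 2} := by
          gcongr
          norm_num
      _ = _ := by norm_num
  calc _ = ((#{S : Finset W | ∑ v ∈ S, deg v = s} : ℝ) * x ^ s) ^ 3 := by ring
    _ ≤ (2 * (1 + x ^ 3) ^ #{v | ¬ deg v = 2}) ^ 3 := by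
        exact pow_le_pow_left₀ (by positivity) (h1.trans h2) 3
    _ = 8 * (1 + x ^ 3) ^ (3 * #{v | ¬ deg v = 2}) := by ring
    _ ≤ _ := by
        gcongr
        have : 0 < x ^ 3 := by positivity
        linarith

/-- Perfect matchings of `H`, encoded as fixed-point-free involutions. -/
def matchings (H : Type*) [Fintype H] [DecidableEq H] : Finset (Equiv.Perm H) :=
  {σ | ∀ i, σ i ≠ i ∧ σ (σ i) = i}

theorem card_eq_two_mul_of_stable {H : Type*} [Fintype H] [LinearOrder H] {σ : Equiv.Perm H}
    (hσ : σ ∈ matchings H) {B : Finset H} (hB : ∀ i ∈ B, σ i ∈ B) :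
    #B = 2 * #{i ∈ B | i < σ i} := by
  simp only [matchings, mem_filter, mem_univ, true_and] at hσ
  have : #{i ∈ B | ¬ i < σ i} = #{i ∈ B | i < σ i} := by
    refine card_bij (fun i _ => σ i) (fun i hi => ?_) (fun i _ j _ h => σ.injective h)
      (fun i hi => ⟨σ i, ?_, (hσ i).2⟩)
    · rw [mem_filter] at hi ⊢
      rw [(hσ i).2]
      exact ⟨hB i hi.1, lt_of_le_of_ne (not_lt.1 hi.2) (hσ i).1⟩
    · rw [mem_filter] at hi ⊢
      rw [(hσ i).2]
      exact ⟨hB i hi.1, not_lt.2 hi.2.le⟩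
  rw [← card_filter_add_card_filter_not (s := B) (fun i => i < σ i), this, two_mul]

theorem card_stable_le {H : Type*} [Fintype H] [LinearOrder H] {σ : Equiv.Perm H} {m : ℕ}
    (hH : Fintype.card H = 2 * m) (hσ : σ ∈ matchings H) (t : ℕ) :
    #{B ∈ powersetCard (2 * t) (univ : Finset H) | ∀ i ∈ B, σ i ∈ B} ≤ m.choose t := by
  have hm : #{i | i < σ i} = m := by
    have := card_eq_two_mul_of_stable hσ (B := univ) (by simp)
    rw [card_univ, hH] at this
    omega
  have hinv : ∀ i, σ i ≠ i ∧ σ (σ i) = i := by simpa [matchings] using hσ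
  have hsub : ∀ B B' : Finset H, (∀ i ∈ B, σ i ∈ B) → (∀ i ∈ B', σ i ∈ B') →
      {i ∈ B | i < σ i} = {i ∈ B' | i < σ i} → B ⊆ B' := by
    intro B B' hB hB' h i hi
    rcases lt_or_gt_of_ne (hinv i).1 with hlt | hgt
    · have : σ i ∈ ({j ∈ B' | j < σ j} : Finset H) := by
        rw [← h, mem_filter, (hinv i).2]
        exact ⟨hB i hi, hlt⟩
      rw [← (hinv i).2]
      exact hB' _ (mem_filter.1 this).1
    · have : i ∈ ({j ∈ B' | j < σ j} : Finset H) := by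
        rw [← h, mem_filter]
        exact ⟨hi, hgt⟩
      exact (mem_filter.1 this).1
  rw [← hm, ← card_powersetCard]
  refine card_le_card_of_injOn (fun B => {i ∈ B | i < σ i}) (fun B hB => ?_) ?_
  · simp only [coe_filter, mem_powersetCard, Set.mem_ofPred_eq] at hB
    have := card_eq_two_mul_of_stable hσ hB.2
    rw [mem_coe, mem_powersetCard]
    exact ⟨filter_subset_filter _ (subset_univ _), by simp only; omega⟩
  · intro B hB B' hB' h
    simp only [coe_filter, Set.mem_ofPred_eq] at hB hB'
    exact (hsub B B' hB.2 hB'.2 h).antisymm (hsub B' B hB'.2 hB.2 h.symm)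

theorem card_matchings_stable_le {H : Type*} [Fintype H] [DecidableEq H] {B B' : Finset H}
    (h : #B = #B') :
    #{σ ∈ matchings H | ∀ i ∈ B, σ i ∈ B} ≤ #{σ ∈ matchings H | ∀ i ∈ B', σ i ∈ B'} := by
  obtain ⟨τ, hτ⟩ : ∃ τ : Equiv.Perm H, ∀ i, τ i ∈ B' ↔ i ∈ B := by
    let e : {x // x ∈ B} ≃ {x // x ∈ B'} := Finset.equivOfCardEq h
    refine ⟨e.extendSubtype, fun i => ⟨fun hi => ?_, fun hi => e.extendSubtype_mem i hi⟩⟩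
    by_contra hn
    exact e.extendSubtype_not_mem i hn hi
  refine card_le_card_of_injOn (fun σ => τ * σ * τ⁻¹) (fun σ hσ => ?_) ?_
  · simp only [matchings, coe_filter, mem_filter, mem_univ, true_and, Set.mem_ofPred_eq,
      Equiv.Perm.mul_apply] at hσ ⊢
    refine ⟨fun i => ⟨fun hi => (hσ.1 (τ⁻¹ i)).1 ?_, ?_⟩, fun i hi => ?_⟩
    · rw [Equiv.Perm.eq_inv_iff_eq]; exact hi
    · simp [(hσ.1 _).2]
    · rw [hτ]
      apply hσ.2
      rw [← hτ]
      simpa using hi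
  · intro σ _ σ' _ h
    simpa using h

theorem card_matchings_stable_mul_le {H : Type*} [Fintype H] [LinearOrder H] {m t : ℕ}
    (hH : Fintype.card H = 2 * m) (htm : t ≤ m) {B : Finset H} (hB : #B = 2 * t) :
    #{σ ∈ matchings H | ∀ i ∈ B, σ i ∈ B} * m.choose t ≤ #(matchings H) := by
  have h1 : #{σ ∈ matchings H | ∀ i ∈ B, σ i ∈ B} * (2 * m).choose (2 * t) ≤
      #(matchings H) * m.choose t := by
    calc _ = ∑ B' ∈ powersetCard (2 * t) (univ : Finset H),
            #{σ ∈ matchings H | ∀ i ∈ B, σ i ∈ B} := by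
          rw [sum_const, card_powersetCard, card_univ, hH, smul_eq_mul, mul_comm]
      _ ≤ ∑ B' ∈ powersetCard (2 * t) (univ : Finset H),
            #{σ ∈ matchings H | ∀ i ∈ B', σ i ∈ B'} :=
          sum_le_sum fun B' hB' =>
            card_matchings_stable_le (hB.trans (mem_powersetCard.1 hB').2.symm)
      _ = ∑ σ ∈ matchings H, #{B ∈ powersetCard (2 * t) (univ : Finset H) | ∀ i ∈ B, σ i ∈ B} :=
          sum_card_bipartiteAbove_eq_sum_card_bipartiteBelow
            (fun (B : Finset H) (σ : Equiv.Perm H) => ∀ i ∈ B, σ i ∈ B)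
      _ ≤ ∑ σ ∈ matchings H, m.choose t := sum_le_sum fun σ hσ => card_stable_le hH hσ t
      _ = _ := by rw [sum_const, smul_eq_mul]
  have h2 : m.choose t * m.choose t ≤ (2 * m).choose (2 * t) := by
    rw [two_mul, two_mul, Nat.add_choose_eq]
    exact single_le_sum (f := fun ij : ℕ × ℕ => m.choose ij.1 * m.choose ij.2)
      (fun _ _ => Nat.zero_le _) (mem_antidiagonal.2 rfl : (t, t) ∈ antidiagonal (t + t))
  refine Nat.le_of_mul_le_mul_right ?_ (Nat.choose_pos htm)
  rw [mul_assoc]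
  exact (Nat.mul_le_mul_left _ h2).trans h1

/-- Sizes `(t, k)` such that a set with `2 * t + k` half-edges, `2 * t` of them matched
internally, can violate `1 / 1000`-expansion. -/
def badSizes (m : ℕ) : Finset (ℕ × ℕ) :=
  {p ∈ Icc 1 m ×ˢ range (m + 1) | 2 * p.1 + p.2 ≤ m ∧ 999 * p.2 < 2 * p.1}

theorem card_nonexpanding_le {H W : Type*} [Fintype H] [LinearOrder H] [Fintype W]
    [DecidableEq W] {deg : W → ℕ} {o : H → W} {m : ℕ} (hH : Fintype.card H = 2 * m)
    (ho : ∀ v, #{i | o i = v} = deg v) :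
    (#{σ ∈ matchings H | ∃ S : Finset W, ∑ v ∈ S, deg v ≤ m ∧
      (#{i | o i ∈ S ∧ o (σ i) ∉ S} : ℝ) < 1 / 1000 * (∑ v ∈ S, deg v : ℕ)} : ℝ) ≤
    (∑ p ∈ badSizes m, (#{S : Finset W | ∑ v ∈ S, deg v = 2 * p.1 + p.2} : ℝ) *
      (2 * p.1 + p.2).choose p.2 / m.choose p.1) * #(matchings H) := by
  have hA : ∀ S : Finset W, #{i | o i ∈ S} = ∑ v ∈ S, deg v := by
    intro S
    rw [card_eq_sum_card_fiberwise (f := o) (t := S) (fun i hi => by simpa using hi)]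
    refine sum_congr rfl fun v hv => ?_
    rw [← ho v, filter_filter]
    congr 1
    ext i
    simp only [mem_filter, mem_univ, true_and]
    exact ⟨fun h => h.2, fun h => ⟨h ▸ hv, h⟩⟩
  have hsub : {σ ∈ matchings H | ∃ S : Finset W, ∑ v ∈ S, deg v ≤ m ∧
      (#{i | o i ∈ S ∧ o (σ i) ∉ S} : ℝ) < 1 / 1000 * (∑ v ∈ S, deg v : ℕ)} ⊆
      (badSizes m).biUnion fun p => ({S | ∑ v ∈ S, deg v = 2 * p.1 + p.2} : Finset _).biUnion
        fun S => (powersetCard (2 * p.1) ({i | o i ∈ S} : Finset H)).biUnion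
          fun B => {σ ∈ matchings H | ∀ i ∈ B, σ i ∈ B} := by
    intro σ hσ
    obtain ⟨hσ, S, hS, he⟩ := mem_filter.1 hσ
    have hinv : ∀ i, σ i ≠ i ∧ σ (σ i) = i := by simpa [matchings] using hσ
    have hB : ∀ i ∈ ({i | o i ∈ S ∧ o (σ i) ∈ S} : Finset H),
        σ i ∈ ({i | o i ∈ S ∧ o (σ i) ∈ S} : Finset H) := by
      intro i hi
      simp only [mem_filter, mem_univ, true_and] at hi ⊢
      rw [(hinv i).2]
      exact hi.symm
    have hcard := card_eq_two_mul_of_stable hσ hB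
    have hadd : #{i | o i ∈ S ∧ o (σ i) ∈ S} + #{i | o i ∈ S ∧ o (σ i) ∉ S} =
        ∑ v ∈ S, deg v := by
      rw [← hA, ← card_filter_add_card_filter_not (s := {i | o i ∈ S})
        (fun i => o (σ i) ∈ S), filter_filter, filter_filter]
    generalize #{i ∈ ({i | o i ∈ S ∧ o (σ i) ∈ S} : Finset H) | i < σ i} = t at hcard
    generalize #{i | o i ∈ S ∧ o (σ i) ∉ S} = k at *
    have he' : 1000 * k < ∑ v ∈ S, deg v := by
      have : (1000 * k : ℝ) < (∑ v ∈ S, deg v : ℕ) := by linarith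
      exact_mod_cast this
    simp only [mem_biUnion]
    refine ⟨(t, k), ?_, S, ?_, _, ?_, mem_filter.2 ⟨hσ, hB⟩⟩
    · simp only [badSizes, mem_filter, mem_product, mem_Icc, mem_range]
      omega
    · simp only [mem_filter, mem_univ, true_and]
      omega
    · rw [mem_powersetCard]
      refine ⟨fun i hi => ?_, hcard⟩
      simp only [mem_filter, mem_univ, true_and] at hi ⊢
      exact hi.1
  have h1 := (card_le_card hsub).trans card_biUnion_le
  refine (Nat.cast_le.2 h1).trans ?_
  rw [Nat.cast_sum, sum_mul]
  refine sum_le_sum fun p hp => ?_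
  simp only [badSizes, mem_filter, mem_product, mem_Icc, mem_range] at hp
  have hC : (0 : ℝ) < m.choose p.1 := by exact_mod_cast Nat.choose_pos (by omega)
  refine (Nat.cast_le.2 card_biUnion_le).trans ?_
  rw [Nat.cast_sum, mul_div_assoc, mul_assoc, ← nsmul_eq_mul]
  refine sum_le_card_nsmul _ _ _ fun S hS => ?_
  refine (Nat.cast_le.2 card_biUnion_le).trans ?_
  rw [Nat.cast_sum, div_mul_eq_mul_div, mul_div_assoc, ← nsmul_eq_mul]
  have hcard : #(powersetCard (2 * p.1) ({i | o i ∈ S} : Finset H)) =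
      (2 * p.1 + p.2).choose p.2 := by
    rw [card_powersetCard, hA, (mem_filter.1 hS).2, ← Nat.choose_symm_add]
  rw [← hcard]
  refine sum_le_card_nsmul _ _ _ fun B hB => ?_
  rw [le_div_iff₀ hC]
  exact_mod_cast card_matchings_stable_mul_le hH (by omega) (mem_powersetCard.1 hB).2

theorem sum_badSizes_le {W : Type*} [Fintype W] [DecidableEq W] {deg : W → ℕ} {m : ℕ}
    (hdeg : ∀ v, 3 ≤ deg v ∨ deg v = 2) (hdeg2 : #{v | deg v = 2} ≤ 1)
    (hsum : ∑ v, deg v = 2 * m) (hm : 1 ≤ m) :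
    ∑ p ∈ badSizes m, (#{S : Finset W | ∑ v ∈ S, deg v = 2 * p.1 + p.2} : ℝ) *
      (2 * p.1 + p.2).choose p.2 / m.choose p.1 ≤
    4 * (8 ^ 4 * 2 ^ 9 * (2 ^ 24 * (Nat.factorial 24)) ^ 2) / m +
      24 * (72 * (2 ^ 24 * (Nat.factorial 24)) ^ 3 / m) ^ (1 / 3 : ℝ) := by
  have hm' : (1 : ℝ) ≤ m := by exact_mod_cast hm
  have hN := card_subsets_pow_three_mul_le hdeg hdeg2 hsum
  rw [← sum_filter_add_sum_filter_not _ (fun p => 24 ≤ p.1)]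
  refine add_le_add ?_ ?_
  · refine (sum_le_card_nsmul _ _ ((8 ^ 4 * 2 ^ 9 * (2 ^ 24 * (Nat.factorial 24)) ^ 2) /
      (m : ℝ) ^ 3) fun p hp => ?_).trans ?_
    · simp only [badSizes, mem_filter, mem_product, mem_Icc, mem_range] at hp
      exact large_term_bound (by positivity) (by omega) hp.2 (by omega)
        fun y hy hy1 => hN _ hy hy1
    · have h1 : #{p ∈ badSizes m | 24 ≤ p.1} ≤ m * (m + 1) := by
        refine (card_le_card ((filter_subset _ _).trans (filter_subset _ _))).trans ?_
        simp
      have h2 : (#{p ∈ badSizes m | 24 ≤ p.1} : ℝ) ≤ m * (m + m) :=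
        (Nat.cast_le.2 h1).trans (by push_cast; gcongr)
      have hK : (0 : ℝ) ≤ 8 ^ 4 * 2 ^ 9 * (2 ^ 24 * (Nat.factorial 24)) ^ 2 := by positivity
      generalize (8 ^ 4 * 2 ^ 9 * (2 ^ 24 * (Nat.factorial 24)) ^ 2 : ℝ) = K at *
      rw [nsmul_eq_mul]
      calc _ ≤ (m * (m + m) : ℝ) * (K / m ^ 3) := by gcongr
        _ = 2 * K / m := by field_simp; ring
        _ ≤ 4 * K / m := by gcongr; norm_num
  · refine (sum_le_card_nsmul _ _ ((72 * (2 ^ 24 * (Nat.factorial 24)) ^ 3 / (m : ℝ)) ^ (1 / 3 : ℝ))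
      fun p hp => ?_).trans ?_
    · simp only [badSizes, mem_filter, mem_product, mem_Icc, mem_range] at hp
      have hp0 : p.2 = 0 := by omega
      rw [hp0]
      simpa using small_term_bound (Nat.cast_nonneg _) (by omega) (by omega) (by omega)
        fun y hy hy1 => hN (2 * p.1) hy hy1
    · rw [nsmul_eq_mul]
      gcongr
      have : {p ∈ badSizes m | ¬ 24 ≤ p.1} ⊆ range 24 ×ˢ range 1 := by
        intro p hp
        simp only [badSizes, mem_filter, mem_product, mem_Icc, mem_range] at hp ⊢
        omega
      exact_mod_cast card_le_card this


/-- Configuration-model kernel expansion: suppose for each `n` we have `V n` vertices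
with degree sequence `deg n`, all degrees at least 3 except possibly one vertex of
degree 2, with even total degree `D n = ∑ v, deg n v = (4+o(1))ε³n → ∞`, where the
half-edges `Fin (D n)` are assigned to vertices via `o n` (vertex `v` owning exactly
`deg n v` half-edges) and matched by a uniform perfect matching (fixed-point free
involution) `σ`. Then there is an absolute constant `α > 0` such that, with probability
tending to 1, every vertex set `S` with `d_K(S) ≤ |E(K)| = D n / 2` satisfies
`e(S, Sᶜ) ≥ α d_K(S)`; i.e. `K` is w.h.p. an `α`-edge-expander. -/
theorem kernel_expander (ε : ℕ → ℝ) (V : ℕ → ℕ) (deg : ∀ n, Fin (V n) → ℕ)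
    (o : ∀ n, Fin (∑ v, deg n v) → Fin (V n))
    (ho : ∀ n v, (Finset.univ.filter fun i => o n i = v).card = deg n v)
    (hdeg : ∀ n v, 3 ≤ deg n v ∨ deg n v = 2)
    (hdeg2 : ∀ n, (Finset.univ.filter fun v => deg n v = 2).card ≤ 1)
    (heven : ∀ n, Even (∑ v, deg n v))
    (hεpos : ∀ n, 0 < ε n)
    (hε0 : Tendsto ε atTop (nhds 0))
    (hε3 : Tendsto (fun n => ε n ^ 3 * n) atTop atTop)
    (hD : Tendsto (fun n => ((∑ v, deg n v : ℕ) : ℝ) / (ε n ^ 3 * n)) atTop (nhds 4)) :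
    ∃ α > (0 : ℝ), Tendsto (fun n =>
      (Nat.card {σ : Equiv.Perm (Fin (∑ v, deg n v)) //
          (∀ i, σ i ≠ i ∧ σ (σ i) = i) ∧
          ∃ S : Finset (Fin (V n)),
            (∑ v ∈ S, deg n v) ≤ (∑ v, deg n v) / 2 ∧
            ((Finset.univ.filter fun i => o n i ∈ S ∧ o n (σ i) ∉ S).card : ℝ) <
              α * (∑ v ∈ S, deg n v)} : ℝ) /
        (Nat.card {σ : Equiv.Perm (Fin (∑ v, deg n v)) // ∀ i, σ i ≠ i ∧ σ (σ i) = i}))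
      atTop (nhds 0) := by
  have hDtop : Tendsto (fun n => (((∑ v, deg n v) / 2 : ℕ) : ℝ)) atTop atTop := by
    have h1 : Tendsto (fun n => ((∑ v, deg n v : ℕ) : ℝ)) atTop atTop := by
      refine (hD.pos_mul_atTop (by norm_num) hε3).congr' ?_
      filter_upwards [hε3.eventually_gt_atTop 0] with n hn
      rw [div_mul_cancel₀ _ hn.ne']
    refine (h1.atTop_div_const (by norm_num : (0 : ℝ) < 2)).congr fun n => ?_
    rw [Nat.cast_div (heven n).two_dvd (by norm_num)]
    norm_num
  refine ⟨1 / 1000, by norm_num, ?_⟩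
  have hlim : Tendsto (fun n =>
      4 * (8 ^ 4 * 2 ^ 9 * (2 ^ 24 * (Nat.factorial 24)) ^ 2) /
        (((∑ v, deg n v) / 2 : ℕ) : ℝ) +
      24 * (72 * (2 ^ 24 * (Nat.factorial 24)) ^ 3 /
        (((∑ v, deg n v) / 2 : ℕ) : ℝ)) ^ (1 / 3 : ℝ)) atTop (nhds 0) := by
    have h1 := hDtop.const_div_atTop (4 * (8 ^ 4 * 2 ^ 9 * (2 ^ 24 * (Nat.factorial 24)) ^ 2))
    have h2 := ((hDtop.const_div_atTop (72 * (2 ^ 24 * (Nat.factorial 24)) ^ 3)).rpow_const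
      (p := 1 / 3) (Or.inr (by norm_num))).const_mul 24
    rw [Real.zero_rpow (by norm_num), mul_zero] at h2
    simpa only [add_zero] using h1.add h2
  refine squeeze_zero' (Eventually.of_forall fun n => by positivity) ?_ hlim
  filter_upwards [hDtop.eventually_ge_atTop 1] with n hn
  have hsum : ∑ v, deg n v = 2 * ((∑ v, deg n v) / 2) := by
    have := (heven n).two_dvd
    omega
  have hbad := (card_nonexpanding_le (by rw [Fintype.card_fin]; exact hsum) (ho n)).trans
    (mul_le_mul_of_nonneg_right
      (sum_badSizes_le (hdeg n) (hdeg2 n) hsum (by exact_mod_cast hn)) (Nat.cast_nonneg _))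
  have hM : (Nat.card {σ : Equiv.Perm (Fin (∑ v, deg n v)) // ∀ i, σ i ≠ i ∧ σ (σ i) = i}) =
      #(matchings (Fin (∑ v, deg n v))) := by
    rw [Nat.card_eq_fintype_card, Fintype.card_subtype, matchings]
    congr!
  rw [hM]
  refine div_le_of_le_mul₀ (Nat.cast_nonneg _) (by positivity) (le_trans (le_of_eq ?_) hbad)
  classical
  rw [Nat.card_eq_fintype_card, Fintype.card_subtype, matchings, filter_filter]
  congr!
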